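/- arXiv:0909.1710 — 6 statements merged into one kernel-verified Lean document; each statement's English description precedes it below -/
import Mathlib

section
/- Let A be a finitely generated abelian group and ψ: A → A an automorphism with finite Reidemeister number R(ψ). Then the fixed point set Fix(ψ) = {a ∈ A : ψ(a) = a} is finite, and moreover R(ψ) ≥ #Fix(ψ). -/
/-- The twisted (`φ`-)conjugacy class of `x`: all elements of the form `g * x * φ g⁻¹`. -/
def twistedClass {G : Type*} [Group G] (φ : G →* G) (x : G) : Set G :=
  {y | ∃ g : G, y = g * x * φ g⁻¹}

/-- If a finite subgroup `K` is its own preimage under an endomorphism `f` whose range has finite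
index, then the kernel of `f` has at most as many elements as its cokernel. -/
theorem AddSubgroup.card_ker_le_index_range_of_comap_eq {M : Type*} [AddCommGroup M]
    (f : M →+ M) (K : AddSubgroup M) [Finite K] (hK : K.comap f = K)
    (hf : f.range.index ≠ 0) : Nat.card f.ker ≤ f.range.index := by
  have hle : f.ker ≤ K := hK ▸ AddSubgroup.ker_le_comap f K
  have hmap : K.map f = K ⊓ f.range := by
    conv_lhs => rw [← hK]
    rw [AddSubgroup.map_comap_eq, inf_comm]
  have hker : Nat.card f.ker * f.ker.relIndex K = Nat.card K := by
    simpa only [AddSubgroup.relIndex_bot_left] using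
      AddSubgroup.relIndex_mul_relIndex ⊥ _ _ bot_le hle
  have hinf : Nat.card (K ⊓ f.range : AddSubgroup M) * (K ⊓ f.range).relIndex K = Nat.card K := by
    simpa only [AddSubgroup.relIndex_bot_left] using
      AddSubgroup.relIndex_mul_relIndex ⊥ _ _ bot_le inf_le_left
  rw [AddSubgroup.relIndex_ker, hmap] at hker
  have : Finite (K ⊓ f.range : AddSubgroup M) :=
    Finite.of_injective _ (AddSubgroup.inclusion_injective inf_le_left)
  have hcard : Nat.card f.ker = f.range.relIndex K := by
    rw [← AddSubgroup.inf_relIndex_left K f.range]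
    refine Nat.eq_of_mul_eq_mul_left (Nat.card_pos (α := (K ⊓ f.range : AddSubgroup M))) ?_
    rw [hinf, ← hker, mul_comm]
  rw [hcard, ← AddSubgroup.relIndex_top_right]
  exact AddSubgroup.relIndex_le_of_le_right le_top (by rwa [AddSubgroup.relIndex_top_right])

/-- If the range of a linear endomorphism has finite index, so do the ranges of its powers. -/
theorem LinearMap.index_range_pow_ne_zero {R M : Type*} [Ring R] [AddCommGroup M] [Module R M]
    (f : M →ₗ[R] M) (hf : (f : M →+ M).range.index ≠ 0) (n : ℕ) :
    ((f ^ n : M →ₗ[R] M) : M →+ M).range.index ≠ 0 := by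
  induction n with
  | zero =>
    have : ((f ^ 0 : M →ₗ[R] M) : M →+ M).range = ⊤ :=
      AddMonoidHom.range_eq_top.2 fun x => ⟨x, rfl⟩
    rw [this, AddSubgroup.index_top]
    exact one_ne_zero
  | succ n ih =>
    have : ((f ^ (n + 1) : M →ₗ[R] M) : M →+ M).range =
        ((f ^ n : M →ₗ[R] M) : M →+ M).range.map (f : M →+ M) := by
      rw [AddMonoidHom.map_range, pow_succ']
      rfl
    rw [this, AddSubgroup.index_map]
    exact mul_ne_zero (ne_zero_of_dvd_ne_zero ih (AddSubgroup.index_dvd_of_le le_sup_left)) hf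

/-- An endomorphism of a Noetherian module with finite cokernel has finite kernel, and the kernel
has at most as many elements as the cokernel. -/
theorem LinearMap.finite_ker_and_card_ker_le_index_range {R M : Type*} [Ring R] [AddCommGroup M]
    [Module R M] [IsNoetherian R M] (f : M →ₗ[R] M) (hf : (f : M →+ M).range.index ≠ 0) :
    Finite (f : M →+ M).ker ∧ Nat.card (f : M →+ M).ker ≤ (f : M →+ M).range.index := by
  obtain ⟨k, hk⟩ := Filter.eventually_atTop.1
    (Module.End.eventually_disjoint_ker_pow_range_pow (R := R) f)
  obtain ⟨l, hl⟩ := monotone_stabilizes_iff_noetherian.2 ‹IsNoetherian R M›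
    (LinearMap.iterateKer f)
  obtain ⟨n, hkn, hln⟩ : ∃ n, k ≤ n ∧ l ≤ n := ⟨max k l, le_max_left .., le_max_right ..⟩
  have hdisj := hk n hkn
  have hstab : LinearMap.ker (f ^ n) = LinearMap.ker (f ^ (n + 1)) :=
    (hl n hln).symm.trans (hl (n + 1) (hln.trans n.le_succ))
  have hindex := f.index_range_pow_ne_zero hf n
  set g : M →ₗ[R] M := f ^ n
  have : (g : M →+ M).range.FiniteIndex := ⟨hindex⟩
  have : Finite (g : M →+ M).ker := by
    refine Finite.of_injective (β := M ⧸ (g : M →+ M).range)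
      (fun x => (x.1 : M ⧸ (g : M →+ M).range)) ?_
    intro x y hxy
    have hmem := QuotientAddGroup.eq.1 hxy
    have hzero := Submodule.disjoint_def.1 hdisj (-x.1 + y.1)
      ((g : M →+ M).ker.add_mem ((g : M →+ M).ker.neg_mem x.2) y.2) hmem
    exact Subtype.ext (neg_add_eq_zero.1 hzero)
  have hcomap : (g : M →+ M).ker.comap (f : M →+ M) = (g : M →+ M).ker := by
    ext x
    have := SetLike.ext_iff.1 hstab x
    rw [pow_succ f n] at this
    exact this.symm
  refine ⟨Finite.of_injective _ (AddSubgroup.inclusion_injective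
    (hcomap ▸ AddSubgroup.ker_le_comap (f : M →+ M) (g : M →+ M).ker)), ?_⟩
  exact AddSubgroup.card_ker_le_index_range_of_comap_eq _ _ hcomap hf

/-- For a finitely generated abelian group `A` and an automorphism `ψ` with finite
Reidemeister number, the fixed point set `Fix(ψ)` is finite and `R(ψ) ≥ #Fix(ψ)`. -/
theorem stmt8 {A : Type*} [CommGroup A] [Group.FG A] (ψ : A ≃* A)
    (hR : (Set.range (twistedClass ψ.toMonoidHom)).Finite) :
    {a : A | ψ a = a}.Finite ∧
      Nat.card {a : A | ψ a = a} ≤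
        Nat.card (Set.range (twistedClass ψ.toMonoidHom)) := by
  let f : Additive A →ₗ[ℤ] Additive A :=
    LinearMap.id - (MonoidHom.toAdditive ψ.toMonoidHom).toIntLinearMap
  have hf : ∀ a : A, f (Additive.ofMul a) = Additive.ofMul (a / ψ a) := fun _ => rfl
  let N : AddSubgroup (Additive A) := (f : Additive A →+ Additive A).range
  let F : Additive A ⧸ N → Set.range (twistedClass ψ.toMonoidHom) :=
    fun q => ⟨_, q.out.toMul, rfl⟩
  have hF : Function.Injective F := by
    intro p q hpq
    have hmem : p.out.toMul ∈ twistedClass ψ.toMonoidHom q.out.toMul := by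
      rw [← show twistedClass ψ.toMonoidHom p.out.toMul = twistedClass ψ.toMonoidHom q.out.toMul
        from congrArg Subtype.val hpq]
      exact ⟨1, by simp⟩
    obtain ⟨g, hg⟩ := hmem
    rw [← QuotientAddGroup.out_eq' p, ← QuotientAddGroup.out_eq' q, eq_comm,
      QuotientAddGroup.eq]
    refine ⟨Additive.ofMul g, (hf g).trans ?_⟩
    apply Additive.toMul.injective
    change g / ψ g = (q.out.toMul)⁻¹ * p.out.toMul
    rw [hg]
    change g / ψ g = (q.out.toMul)⁻¹ * (g * q.out.toMul * ψ g⁻¹)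
    rw [map_inv, div_eq_mul_inv, mul_comm g q.out.toMul, mul_assoc, inv_mul_cancel_left]
  have : Finite (Set.range (twistedClass ψ.toMonoidHom)) := hR
  have : Finite (Additive A ⧸ N) := Finite.of_injective F hF
  have : Module.Finite ℤ (Additive A) := Module.Finite.iff_addGroup_fg.2 inferInstance
  have hindex : N.index ≠ 0 := AddSubgroup.index_ne_zero_of_finite
  obtain ⟨hfin, hcard⟩ := f.finite_ker_and_card_ker_le_index_range hindex
  let e : {a : A | ψ a = a} ≃ (f : Additive A →+ Additive A).ker :=
    Additive.ofMul.subtypeEquiv fun a => by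
      change ψ a = a ↔ a / ψ a = 1
      rw [div_eq_one, eq_comm]
  refine ⟨Finite.of_equiv _ e.symm, ?_⟩
  rw [Nat.card_congr e]
  exact hcard.trans (Nat.card_le_card_of_injective F hF)
end

section
/- Let G be a finitely generated FC-group (i.e. every conjugacy class of G is finite) and φ: G → G an automorphism with finite Reidemeister number R(φ). Then the fixed point set Fix(φ) = {g ∈ G : φ(g) = g} is finite. The same conclusion holds for τ_x ∘ φ for every x ∈ G; hence the set of g ∈ G such that g * x * φ(g⁻¹) = x for some x ∈ G is finite. -/
open Subgroup

/-- An endomorphism of a finitely generated abelian group whose image has finite index has finite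
kernel. -/
theorem MonoidHom.finite_ker_of_finiteIndex_range {A : Type*} [CommGroup A] [Group.FG A]
    (f : A →* A) (hf : f.range.FiniteIndex) : Finite f.ker := by
  let F : Additive A →ₗ[ℤ] Additive A := f.toAdditive.toIntLinearMap
  have : Module.Finite ℤ (Additive A) := Module.Finite.iff_addGroup_fg.mpr inferInstance
  have hquot : Module.IsTorsion ℤ (Additive A ⧸ LinearMap.range F) := by
    intro q
    obtain ⟨a, rfl⟩ := Submodule.Quotient.mk_surjective _ q
    obtain ⟨b, hb⟩ := f.range.pow_index_mem a.toMul
    refine ⟨⟨(f.range.index : ℤ), ?_⟩, ?_⟩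
    · exact mem_nonZeroDivisors_of_ne_zero (by exact_mod_cast hf.index_ne_zero)
    · change (f.range.index : ℤ) • (Submodule.Quotient.mk a : Additive A ⧸ LinearMap.range F) = 0
      rw [← Submodule.Quotient.mk_smul, Submodule.Quotient.mk_eq_zero]
      refine ⟨Additive.ofMul b, ?_⟩
      rw [natCast_zsmul]
      exact hb
  have hker : Module.finrank ℤ (LinearMap.ker F) = 0 := by
    have h₁ := Submodule.finrank_quotient_add_finrank (LinearMap.range F)
    have h₂ := Submodule.finrank_quotient_add_finrank (LinearMap.ker F)
    rw [Module.finrank_eq_zero_iff_isTorsion.mpr hquot] at h₁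
    rw [F.quotKerEquivRange.finrank_eq] at h₂
    omega
  have hfin : Finite (LinearMap.ker F) :=
    Module.finite_of_fg_torsion _ (Module.finrank_eq_zero_iff_isTorsion.mp hker)
  exact hfin

/-- The centre of a finitely generated FC-group has finite index. -/
theorem Subgroup.finiteIndex_center_of_finite_conj {G : Type*} [Group G] [Group.FG G]
    (hFC : ∀ g : G, {x : G | IsConj g x}.Finite) : (center G).FiniteIndex := by
  obtain ⟨S, hS⟩ := Group.FG.out (G := G)
  rw [center_eq_iInf hS]
  refine finiteIndex_iInf' _ fun g _ ↦ ?_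
  have horbit : MulAction.orbit (ConjAct G) g = {x : G | IsConj g x} := by
    ext x
    exact ConjAct.mem_orbit_conjAct.trans isConj_comm
  have hindex := MulAction.index_stabilizer (ConjAct G) g
  rw [ConjAct.stabilizer_eq_centralizer, horbit] at hindex
  refine ⟨fun h ↦ ?_⟩
  have hpos := (Set.ncard_pos (hFC g)).mpr ⟨g, IsConj.refl g⟩
  exact hpos.ne' (hindex.symm.trans h)

/-- Composing with an inner automorphism preserves finiteness of the Reidemeister number. -/
theorem finite_range_twistedClass_conj {G : Type*} [Group G] (φ : G ≃* G)
    (hR : (Set.range (twistedClass φ.toMonoidHom)).Finite) (x : G) :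
    (Set.range (twistedClass (φ.trans (MulAut.conj x)).toMonoidHom)).Finite := by
  refine (hR.image fun C ↦ (· * x) ⁻¹' C).subset ?_
  rintro _ ⟨y, rfl⟩
  refine ⟨_, ⟨y * x, rfl⟩, ?_⟩
  ext z
  refine exists_congr fun g ↦ ?_
  simp [← mul_assoc, ← eq_mul_inv_iff_mul_eq]

open scoped IsMulCommutative in
/-- If the centre has finite index and is finitely generated, an automorphism with finite
Reidemeister number has finitely many fixed points. -/
theorem finite_fixedPoints_of_finite_range_twistedClass {G : Type*} [Group G]
    [Group.FG (center G)] [(center G).FiniteIndex] (ψ : G ≃* G)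
    (hR : (Set.range (twistedClass ψ.toMonoidHom)).Finite) : {g : G | ψ g = g}.Finite := by
  let f : center G →* center G := MonoidHom.id (center G) / (centerCongr ψ).toMonoidHom
  have hf (c : center G) : (f c : G) = c * (ψ c)⁻¹ := by
    simp [f, div_eq_mul_inv]; rfl
  have hrange : f.range.FiniteIndex := by
    have : Finite (center G ⧸ f.range) := by
      rw [← Set.finite_univ_iff]
      refine Set.Finite.of_finite_fibers
        (fun q ↦ twistedClass ψ.toMonoidHom (q.out : G)) (hR.subset ?_) ?_
      · rintro _ ⟨q, -, rfl⟩
        exact ⟨_, rfl⟩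
      · rintro _ ⟨q₀, -, rfl⟩
        have hconj (q : center G ⧸ f.range)
            (hq : twistedClass ψ.toMonoidHom (q.out : G) =
              twistedClass ψ.toMonoidHom (q₀.out : G)) :
            ∃ g : G, (q.out : G) = g * q₀.out * ψ g⁻¹ := by
          have hmem : (q.out : G) ∈ twistedClass ψ.toMonoidHom (q.out : G) := ⟨1, by simp⟩
          rwa [hq] at hmem
        choose! γ hγ using hconj
        refine Set.Finite.of_injOn (f := fun q ↦ (γ q : G ⧸ center G)) (t := Set.univ)
          (fun _ _ ↦ Set.mem_univ _) ?_ Set.finite_univ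
        rintro q ⟨-, hq⟩ r ⟨-, hr⟩ hqr
        have hc := QuotientGroup.eq.mp hqr
        have hq' := hγ q hq
        have hr' := hγ r hr
        rw [← q.out_eq', ← r.out_eq']
        let d : center G := ⟨_, hc⟩
        refine QuotientGroup.eq.mpr ⟨d, Subtype.ext ?_⟩
        have hd : γ r = γ q * d := by simp [d]
        have hcomm₁ := mem_center_iff.mp d.2 (q₀.out : G)
        have hcomm₂ := mem_center_iff.mp (f d).2 (ψ (γ q))⁻¹
        have hmul : (r.out : G) = q.out * f d := calc
          (r.out : G) = γ q * (d * q₀.out) * ((ψ d)⁻¹ * (ψ (γ q))⁻¹) := by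
            rw [hr', hd]; simp [mul_assoc]
          _ = γ q * q₀.out * (f d * (ψ (γ q))⁻¹) := by
            rw [← hcomm₁, hf]; simp only [mul_assoc]
          _ = q.out * f d := by
            rw [← hcomm₂, hq', map_inv]; simp only [mul_assoc]
        rw [coe_mul, coe_inv, hmul, inv_mul_cancel_left]
    exact finiteIndex_of_finite_quotient
  have hker := f.finite_ker_of_finiteIndex_range hrange
  have hfix (c : G) (hc : c ∈ center G) (h : ψ c = c) : (⟨c, hc⟩ : center G) ∈ f.ker :=
    Subtype.ext (by rw [hf]; simp [h])
  refine Set.Finite.of_finite_fibers (fun g : G ↦ (g : G ⧸ center G))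
    (Set.finite_univ.subset (Set.subset_univ _)) ?_
  rintro _ ⟨a, ha, rfl⟩
  refine ((Set.toFinite (f.ker : Set (center G))).image fun c : center G ↦ a * (c : G)).subset ?_
  rintro b ⟨hb, hab⟩
  have hc := QuotientGroup.eq.mp (Eq.symm hab)
  refine ⟨⟨a⁻¹ * b, hc⟩, hfix _ hc ?_, by simp⟩
  rw [map_mul, map_inv, show ψ a = a from ha, show ψ b = b from hb]

/-- For a finitely generated FC-group `G` (all conjugacy classes finite) and an
automorphism `φ` with finite Reidemeister number, `Fix(φ)` is finite; the same holds
for `τ_x ∘ φ` for every `x`, and hence the set of `g` with `g * x * φ(g⁻¹) = x`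
for some `x` is finite. -/
theorem stmt12 {G : Type*} [Group G] [Group.FG G]
    (hFC : ∀ g : G, {x : G | IsConj g x}.Finite)
    (φ : G ≃* G)
    (hR : (Set.range (twistedClass φ.toMonoidHom)).Finite) :
    {g : G | φ g = g}.Finite ∧
    (∀ x : G, {g : G | x * φ g * x⁻¹ = g}.Finite) ∧
    {g : G | ∃ x : G, g * x * φ g⁻¹ = x}.Finite := by
  have hZ := finiteIndex_center_of_finite_conj hFC
  have hconj (x : G) : {g : G | x * φ g * x⁻¹ = g}.Finite :=
    finite_fixedPoints_of_finite_range_twistedClass (φ.trans (MulAut.conj x))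
      (finite_range_twistedClass_conj φ hR x)
  refine ⟨by simpa using hconj 1, hconj, ?_⟩
  refine (Set.finite_iUnion fun q : G ⧸ center G ↦ hconj q.out).subset ?_
  rintro g ⟨x, hx⟩
  obtain ⟨c, hc⟩ := QuotientGroup.mk_out_eq_mul (center G) x
  have hcomm := mem_center_iff.mp c.2 (φ g)
  refine Set.mem_iUnion.mpr ⟨(x : G ⧸ center G), ?_⟩
  have hg : g * x = x * φ g := by
    rwa [map_inv, mul_inv_eq_iff_eq_mul] at hx
  rw [Set.mem_ofPred_eq, hc, mul_inv_eq_iff_eq_mul, mul_assoc, ← hcomm, ← mul_assoc, ← hg, mul_assoc]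
end

section
/- Let G be a finitely generated group and φ: G → G an automorphism with R(φ) < ∞. Then RP(φ) holds (i.e. there exist a finite group W, an automorphism φ_W of W, and a surjective homomorphism F: G → W with F ∘ φ = φ_W ∘ F such that every φ-conjugacy class of G is the full preimage under F of a subset of W) if and only if for every φ-conjugacy class C ⊆ G the collection of left translates {g·C : g ∈ G} is a finite collection of subsets of G. -/
/-- `W` is a witness for the property RP(φ): `W` is a finite group and there exist
an automorphism `φ_W` of `W` and an epimorphism `F : G → W` with `F ∘ φ = φ_W ∘ F`
such that every `φ`-conjugacy class of `G` is the full preimage under `F`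
of a subset of `W`. -/
def IsRPWitness {G : Type*} [Group G] (φ : G →* G) (W : Type) [Group W] : Prop :=
  Finite W ∧ ∃ (φW : W ≃* W) (F : G →* W),
    Function.Surjective F ∧ (∀ g : G, F (φ g) = φW (F g)) ∧
    ∀ x : G, ∃ S : Set W, twistedClass φ x = F ⁻¹' S

/-- The property RP(φ): existence of a finite group witness as above. -/
def RPcond {G : Type*} [Group G] (φ : G →* G) : Prop :=
  ∃ (W : Type) (inst : Group W), @IsRPWitness G _ φ W inst

open scoped Pointwise

section TwistedConjugacy

variable {G : Type*} [Group G]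

/-- An automorphism preserves each of its twisted conjugacy classes. -/
theorem map_mem_twistedClass_iff (φ : G ≃* G) (x y : G) :
    φ y ∈ twistedClass φ.toMonoidHom x ↔ y ∈ twistedClass φ.toMonoidHom x := by
  constructor
  · rintro ⟨g, hg⟩
    refine ⟨y * g, ?_⟩
    have h : g * x = φ y * φ g := by simp [show φ y = g * x * φ g⁻¹ from hg]
    simp [mul_assoc, h]
  · rintro ⟨g, hg⟩
    refine ⟨y⁻¹ * g, ?_⟩
    have h : g * x = y * φ g := by simp [show y = g * x * φ g⁻¹ from hg]
    simp [mul_assoc, h]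

theorem mul_mul_mem_twistedClass_iff (φ : G →* G) (x g y : G) :
    g * y * φ g⁻¹ ∈ twistedClass φ x ↔ y ∈ twistedClass φ x := by
  constructor
  · rintro ⟨a, ha⟩
    refine ⟨g⁻¹ * a, ?_⟩
    have h : g * y = a * (x * (φ a)⁻¹ * φ g) := by
      rw [map_inv, mul_inv_eq_iff_eq_mul] at ha
      simpa [mul_assoc] using ha
    rw [show g⁻¹ * a * x * φ (g⁻¹ * a)⁻¹ = g⁻¹ * (a * (x * (φ a)⁻¹ * φ g)) by simp [mul_assoc], ← h,
      inv_mul_cancel_left]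
  · rintro ⟨a, rfl⟩
    exact ⟨g * a, by simp [mul_assoc]⟩

theorem mem_stabilizer_set_iff_forall_mul_mem (h : G) (C : Set G) :
    h ∈ MulAction.stabilizer G C ↔ ∀ y, h * y ∈ C ↔ y ∈ C :=
  MulAction.mem_stabilizer_set

theorem stabilizer_twistedClass_normal (φ : G →* G) (x : G) :
    (MulAction.stabilizer G (twistedClass φ x)).Normal := by
  refine ⟨fun h hh g => ?_⟩
  rw [mem_stabilizer_set_iff_forall_mul_mem] at hh ⊢
  intro y
  rw [← mul_mul_mem_twistedClass_iff φ x g⁻¹, ← mul_mul_mem_twistedClass_iff φ x g⁻¹ y,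
    ← hh (g⁻¹ * y * φ g⁻¹⁻¹)]
  simp [mul_assoc]

theorem map_mem_stabilizer_twistedClass_iff (φ : G ≃* G) (x h : G) :
    φ h ∈ MulAction.stabilizer G (twistedClass φ.toMonoidHom x) ↔
      h ∈ MulAction.stabilizer G (twistedClass φ.toMonoidHom x) := by
  simp only [mem_stabilizer_set_iff_forall_mul_mem]
  rw [φ.surjective.forall]
  simp only [← map_mul, map_mem_twistedClass_iff]

theorem eq_preimage_mk_image_of_le_stabilizer {N : Subgroup G} [N.Normal] {C : Set G}
    (hN : N ≤ MulAction.stabilizer G C) :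
    C = QuotientGroup.mk' N ⁻¹' (QuotientGroup.mk' N '' C) := by
  refine Set.Subset.antisymm (Set.subset_preimage_image _ _) ?_
  rintro y ⟨c, hc, hcy⟩
  have hmem : y * c⁻¹ ∈ N := by
    rw [← QuotientGroup.eq_one_iff, QuotientGroup.mk_mul, QuotientGroup.mk_inv]
    exact mul_inv_eq_one.mpr hcy.symm
  simpa using ((mem_stabilizer_set_iff_forall_mul_mem _ _).mp (hN hmem) c).mpr hc

theorem finite_range_translates_preimage {W : Type*} [Group W] [Finite W] (F : G →* W)
    (S : Set W) : (Set.range fun g : G => (fun x => g * x) '' (F ⁻¹' S)).Finite := by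
  refine (Set.finite_range fun w : W => F ⁻¹' (w • S)).subset ?_
  rintro _ ⟨g, rfl⟩
  refine ⟨F g, ?_⟩
  ext y
  simp [Set.mem_smul_set_iff_inv_smul_mem]

/-- A finite-index normal subgroup that is preserved by `φ` and stabilizes every twisted conjugacy
class yields a witness for `RPcond`. -/
theorem rpcond_of_le_stabilizer (φ : G ≃* G) (N : Subgroup G) [N.Normal] [N.FiniteIndex]
    (hφ : N.map φ.toMonoidHom = N)
    (hN : ∀ x, N ≤ MulAction.stabilizer G (twistedClass φ.toMonoidHom x)) :
    RPcond φ.toMonoidHom := by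
  let e : Shrink.{0} (G ⧸ N) ≃* G ⧸ N := Shrink.mulEquiv
  refine ⟨Shrink.{0} (G ⧸ N), inferInstance, Finite.of_equiv _ e.symm.toEquiv,
    (e.trans (QuotientGroup.congr N N φ hφ)).trans e.symm,
    e.symm.toMonoidHom.comp (QuotientGroup.mk' N),
    e.symm.surjective.comp (QuotientGroup.mk'_surjective N), fun g => ?_, fun x => ?_⟩
  · simp only [MonoidHom.comp_apply, MulEquiv.coe_toMonoidHom, MulEquiv.trans_apply,
      MulEquiv.apply_symm_apply]
    rfl
  refine ⟨e ⁻¹' (QuotientGroup.mk' N '' twistedClass φ.toMonoidHom x), ?_⟩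
  conv_lhs => rw [eq_preimage_mk_image_of_le_stabilizer (hN x)]
  ext y
  simp

end TwistedConjugacy

/-- For a finitely generated group `G` and an automorphism `φ` with `R(φ) < ∞`,
RP(φ) holds iff for every `φ`-conjugacy class `C`, the collection of left
translates `{g • C : g ∈ G}` is finite. -/
theorem stmt13 {G : Type*} [Group G] [Group.FG G] (φ : G ≃* G)
    (hR : (Set.range (twistedClass φ.toMonoidHom)).Finite) :
    RPcond φ.toMonoidHom ↔
      ∀ C ∈ Set.range (twistedClass φ.toMonoidHom),
        (Set.range fun g : G => (fun x => g * x) '' C).Finite := by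
  constructor
  · rintro ⟨W, _, _, -, F, -, -, hF⟩ _ ⟨x, rfl⟩
    obtain ⟨S, hS⟩ := hF x
    rw [hS]
    exact finite_range_translates_preimage F S
  · intro hC
    have := hR.to_subtype
    let N : Subgroup G :=
      ⨅ C : Set.range (twistedClass φ.toMonoidHom), MulAction.stabilizer G (C : Set G)
    have : N.Normal := by
      refine Subgroup.normal_iInf_normal ?_
      rintro ⟨_, x, rfl⟩
      exact stabilizer_twistedClass_normal _ x
    have : N.FiniteIndex := by
      refine Subgroup.finiteIndex_iInf fun C => ⟨?_⟩
      rw [MulAction.index_stabilizer]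
      exact Set.ncard_ne_zero_of_mem (MulAction.mem_orbit_self _) (hC C C.2)
    have hmem (h : G) : φ h ∈ N ↔ h ∈ N := by
      simp only [N, Subgroup.mem_iInf, Subtype.forall, Set.forall_mem_range,
        map_mem_stabilizer_twistedClass_iff]
    refine rpcond_of_le_stabilizer φ N ?_ fun x => iInf_le_of_le ⟨_, x, rfl⟩ le_rfl
    ext y
    obtain ⟨h, rfl⟩ := φ.surjective y
    rw [hmem]
    exact Subgroup.mem_map_iff_mem φ.injective
end

section
/- Every finitely generated nilpotent group has property RP: for every automorphism φ of a finitely generated nilpotent group G with R(φ) < ∞, there exist a finite group W, an automorphism φ_W of W, and a surjective homomorphism F: G → W with F ∘ φ = φ_W ∘ F such that every φ-conjugacy class of G is the full preimage under F of a subset of W. -/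
open Subgroup
open scoped commutatorElement IsMulCommutative

theorem wellFoundedGT_subgroup_multiplicative_int : WellFoundedGT (Subgroup (Multiplicative ℤ)) :=
  (AddSubgroup.toSubgroup.symm.trans AddSubgroup.toIntSubmodule :
    Subgroup (Multiplicative ℤ) ≃o Submodule ℤ ℤ).strictMono.wellFoundedGT

theorem wellFoundedGT_Iic_sup_zpowers {G : Type*} [Group G] (N : Subgroup G) [N.Normal] (s : G)
    [WellFoundedGT (Set.Iic N)] : WellFoundedGT (Set.Iic (N ⊔ zpowers s)) := by
  have := wellFoundedGT_subgroup_multiplicative_int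
  let f : Set.Iic (N ⊔ zpowers s) → Set.Iic N × Subgroup (Multiplicative ℤ) := fun H =>
    (⟨H.1 ⊓ N, Set.mem_Iic.2 inf_le_right⟩, (H.1 ⊔ N).comap (zpowersHom G s))
  have hmono : Monotone f := fun H K h =>
    ⟨inf_le_inf_right N h, comap_mono (sup_le_sup_right (Subtype.coe_le_coe.2 h) N)⟩
  refine StrictMono.wellFoundedGT (f := f) fun H K hHK => lt_of_le_of_ne (hmono hHK.le) fun h => ?_
  refine hHK.not_ge fun x hx => ?_
  obtain ⟨n, hn, y, ⟨k, rfl⟩, rfl⟩ := mem_sup_of_normal_left.1 (K.2 hx)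
  have h1 : H.1 ⊓ N = K.1 ⊓ N := congrArg (fun p => p.1.1) h
  have h2 : (H.1 ⊔ N).comap (zpowersHom G s) = (K.1 ⊔ N).comap (zpowersHom G s) :=
    congrArg Prod.snd h
  have h3 : s ^ k ∈ K.1 ⊔ N := by
    have := mul_mem (inv_mem (mem_sup_right hn : n ∈ K.1 ⊔ N)) (mem_sup_left hx)
    simpa using this
  have h4 : Multiplicative.ofAdd k ∈ (H.1 ⊔ N).comap (zpowersHom G s) := by
    rw [h2]; simpa using h3
  have h5 : s ^ k ∈ N ⊔ H.1 := by rw [sup_comm]; simpa using h4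
  obtain ⟨m, hm, y, hy, hmy⟩ := mem_sup_of_normal_left.1 h5
  have hyK : y ∈ K.1 := hHK.le hy
  have h6 : n * m ∈ K.1 ⊓ N := by
    refine ⟨?_, mul_mem hn hm⟩
    have := mul_mem hx (inv_mem hyK)
    simpa [← hmy, mul_assoc] using this
  rw [← h1] at h6
  have := mul_mem h6.1 hy
  simpa [← hmy, mul_assoc] using this

theorem normal_of_lowerCentralSeries_le {G : Type*} [Group G] {n : ℕ} {L : Subgroup G}
    (h1 : (⊤ : Subgroup G).lowerCentralSeries (n + 1) ≤ L)
    (h2 : L ≤ (⊤ : Subgroup G).lowerCentralSeries n) : L.Normal := by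
  refine ⟨fun x hx g => ?_⟩
  have h : ⁅x, g⁆ ∈ L := h1 (commutator_mem_commutator (h2 hx) (mem_top g))
  have := mul_mem (inv_mem h) hx
  simpa [commutatorElement_def, mul_assoc] using this

theorem mk_mul_comm_iff_commutatorElement_mem {G : Type*} [Group G] (L : Subgroup G) [L.Normal]
    (x g : G) : (x : G ⧸ L) * g = g * x ↔ ⁅x, g⁆ ∈ L := by
  rw [← QuotientGroup.eq_one_iff, ← commutatorElement_eq_one_iff_mul_comm]
  rfl

theorem exists_finset_lowerCentralSeries_eq {G : Type*} [Group G] [Group.FG G] (n : ℕ) :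
    ∃ S : Finset G, (⊤ : Subgroup G).lowerCentralSeries n =
      (⊤ : Subgroup G).lowerCentralSeries (n + 1) ⊔ closure S := by
  classical
  obtain ⟨T, hT⟩ := Group.fg_def.1 ‹Group.FG G›
  induction n with
  | zero => exact ⟨T, by simp [hT]⟩
  | succ n ih =>
    obtain ⟨S, hS⟩ := ih
    have hSγ : ∀ s ∈ S, s ∈ (⊤ : Subgroup G).lowerCentralSeries n := fun s hs => by
      rw [hS]
      exact mem_sup_right (subset_closure hs)
    have hanti : (⊤ : Subgroup G).lowerCentralSeries (n + 1 + 1) ≤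
        (⊤ : Subgroup G).lowerCentralSeries (n + 1) :=
      Subgroup.lowerCentralSeries_antitone _ (Nat.le_succ _)
    have hcl : closure (Finset.image₂ (fun s t => ⁅s, t⁆) S T : Set G) ≤
        (⊤ : Subgroup G).lowerCentralSeries (n + 1) := by
      rw [closure_le]
      intro x hx
      obtain ⟨s, hs, t, -, rfl⟩ := Finset.mem_image₂.1 (Finset.mem_coe.1 hx)
      exact commutator_mem_commutator (hSγ s hs) (mem_top t)
    refine ⟨Finset.image₂ (fun s t => ⁅s, t⁆) S T, le_antisymm ?_ (sup_le hanti hcl)⟩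
    set L := (⊤ : Subgroup G).lowerCentralSeries (n + 1 + 1) ⊔
      closure (Finset.image₂ (fun s t => ⁅s, t⁆) S T : Set G)
    have hLn : L.Normal := normal_of_lowerCentralSeries_le le_sup_left (sup_le hanti hcl)
    have hγC : (⊤ : Subgroup G).lowerCentralSeries n ≤
        (center (G ⧸ L)).comap (QuotientGroup.mk' L) := by
      rw [hS, sup_le_iff, closure_le]
      refine ⟨fun x hx => mem_center_iff.2 fun q => ?_, fun s hs => mem_center_iff.2 fun q => ?_⟩
      · obtain ⟨g, rfl⟩ := QuotientGroup.mk_surjective q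
        exact ((mk_mul_comm_iff_commutatorElement_mem L x g).2
          (mem_sup_left (commutator_mem_commutator hx (mem_top g)))).symm
      · have hle : (⊤ : Subgroup G) ≤
            (centralizer {(s : G ⧸ L)}).comap (QuotientGroup.mk' L) := by
          rw [← hT, closure_le]
          exact fun t ht => mem_centralizer_singleton_iff.2
            ((mk_mul_comm_iff_commutatorElement_mem L s t).2 (mem_sup_right
              (subset_closure (Finset.mem_coe.2 (Finset.mem_image₂_of_mem hs ht))))).symm
        obtain ⟨g, rfl⟩ := QuotientGroup.mk_surjective q
        exact mem_centralizer_singleton_iff.1 (hle (mem_top g))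
    change ⁅(⊤ : Subgroup G).lowerCentralSeries n, (⊤ : Subgroup G)⁆ ≤ L
    rw [commutator_le]
    exact fun x hx g _ => (mk_mul_comm_iff_commutatorElement_mem L x g).1
      (mem_center_iff.1 (hγC hx) g).symm

theorem wellFoundedGT_Iic_lowerCentralSeries {G : Type*} [Group G] [Group.FG G] (n : ℕ)
    [WellFoundedGT (Set.Iic ((⊤ : Subgroup G).lowerCentralSeries (n + 1)))] :
    WellFoundedGT (Set.Iic ((⊤ : Subgroup G).lowerCentralSeries n)) := by
  classical
  obtain ⟨S, hS⟩ := exists_finset_lowerCentralSeries_eq (G := G) n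
  have key : ∀ T : Finset G, T ⊆ S → WellFoundedGT
      (Set.Iic ((⊤ : Subgroup G).lowerCentralSeries (n + 1) ⊔ closure (T : Set G))) := by
    intro T
    induction T using Finset.induction_on with
    | empty =>
      intro _
      rwa [Finset.coe_empty, Subgroup.closure_empty, sup_bot_eq]
    | insert a T ha ih =>
      intro h
      have := ih ((Finset.subset_insert a T).trans h)
      have hn : ((⊤ : Subgroup G).lowerCentralSeries (n + 1) ⊔ closure (T : Set G)).Normal := by
        refine normal_of_lowerCentralSeries_le le_sup_left ?_
        rw [hS]
        exact sup_le_sup_left (closure_mono ((Finset.subset_insert a T).trans h)) _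
      have := wellFoundedGT_Iic_sup_zpowers
        ((⊤ : Subgroup G).lowerCentralSeries (n + 1) ⊔ closure (T : Set G)) a
      rwa [sup_assoc, zpowers_eq_closure, ← Subgroup.closure_union, Set.union_comm, ← Set.insert_eq,
        ← Finset.coe_insert] at this
  rw [hS]
  exact key S subset_rfl

theorem wellFoundedGT_subgroup_of_fg_of_isNilpotent (G : Type*) [Group G] [Group.FG G]
    [Group.IsNilpotent G] : WellFoundedGT (Subgroup G) := by
  obtain ⟨n, hn⟩ := Subgroup.nilpotent_iff_lowerCentralSeries.1 ‹Group.IsNilpotent G›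
  have h : ∀ k, WellFoundedGT (Set.Iic ((⊤ : Subgroup G).lowerCentralSeries (n - k))) := by
    intro k
    induction k with
    | zero =>
      rw [Nat.sub_zero, hn]
      have : Finite (Set.Iic (⊥ : Subgroup G)) := by rw [Set.Iic_bot]; infer_instance
      infer_instance
    | succ k ih =>
      by_cases hk : k < n
      · rw [show n - k = n - (k + 1) + 1 by omega] at ih
        exact wellFoundedGT_Iic_lowerCentralSeries _
      · rwa [show n - (k + 1) = n - k by omega]
  have h0 := h n
  rw [Nat.sub_self, Subgroup.lowerCentralSeries_zero] at h0
  exact StrictMono.wellFoundedGT (f := fun H : Subgroup G => (⟨H, le_top⟩ : Set.Iic ⊤))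
    fun _ _ h => h

theorem fg_of_wellFoundedGT_subgroup (G : Type*) [Group G] [WellFoundedGT (Subgroup G)] :
    Group.FG G := by
  obtain ⟨H, hH, hmax⟩ := WellFounded.has_min (wellFounded_gt (α := Subgroup G))
    {H : Subgroup G | H.FG} ⟨⊥, FG.bot⟩
  refine Group.fg_def.2 ?_
  suffices H = ⊤ by rwa [← this]
  refine eq_top_iff.2 fun g _ => ?_
  have hfg : (H ⊔ zpowers g).FG := FG.sup hH (by
    rw [zpowers_eq_closure]
    exact ⟨{g}, by simp⟩)
  by_contra hg
  refine hmax _ hfg (lt_of_le_of_ne le_sup_left fun h => hg ?_)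
  rw [h]
  exact mem_sup_right (mem_zpowers g)

theorem wellFoundedGT_subgroup_subgroup {G : Type*} [Group G] [WellFoundedGT (Subgroup G)]
    (H : Subgroup G) : WellFoundedGT (Subgroup H) :=
  have hmono : Monotone (Subgroup.map H.subtype) := fun _ _ h => map_mono h
  (hmono.strictMono_of_injective (map_injective H.subtype_injective)).wellFoundedGT

theorem wellFoundedGT_subgroup_quotient {G : Type*} [Group G] [WellFoundedGT (Subgroup G)]
    (N : Subgroup G) [N.Normal] : WellFoundedGT (Subgroup (G ⧸ N)) :=
  have hmono : Monotone (Subgroup.comap (QuotientGroup.mk' N)) := fun _ _ h => comap_mono h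
  (hmono.strictMono_of_injective
    (comap_injective (QuotientGroup.mk'_surjective N))).wellFoundedGT

theorem finite_center_of_isOfFinOrder {G : Type*} [Group G] [WellFoundedGT (Subgroup G)]
    (h : ∀ z ∈ center G, IsOfFinOrder z) : Finite (center G) := by
  have := wellFoundedGT_subgroup_subgroup (center G)
  have := fg_of_wellFoundedGT_subgroup (center G)
  exact CommGroup.finite_of_fg_isMulTorsion _ fun z =>
    Submonoid.isOfFinOrder_coe.1 (h z z.2)

theorem finite_of_isOfFinOrder (G : Type*) [Group G] [Group.IsNilpotent G]
    [WellFoundedGT (Subgroup G)] (h : ∀ g : G, IsOfFinOrder g) : Finite G := by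
  refine Group.nilpotent_center_quotient_ind (P := fun G _ _ =>
    WellFoundedGT (Subgroup G) → (∀ g : G, IsOfFinOrder g) → Finite G) G ?_ ?_ ‹_› h
  · intro G _ _ _ _
    infer_instance
  · intro G _ _ ih _ h
    have := wellFoundedGT_subgroup_quotient (center G)
    have := ih this fun q => by
      obtain ⟨g, rfl⟩ := QuotientGroup.mk_surjective q
      exact MonoidHom.isOfFinOrder (QuotientGroup.mk' _) (h g)
    have := finite_center_of_isOfFinOrder fun z _ => h z
    exact Finite.of_subgroup_quotient (center G)

theorem exists_pow_eq_one_of_center (G : Type*) [Group G] [Group.IsNilpotent G] {n : ℕ}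
    (hn : 0 < n) (h : ∀ z ∈ center G, z ^ n = 1) : ∃ m, 0 < m ∧ ∀ g : G, g ^ m = 1 := by
  revert h
  refine Group.nilpotent_center_quotient_ind (P := fun G _ _ =>
    (∀ z ∈ center G, z ^ n = 1) → ∃ m, 0 < m ∧ ∀ g : G, g ^ m = 1) G ?_ ?_
  · intro G _ _ _
    exact ⟨1, one_pos, fun g => Subsingleton.elim _ _⟩
  · intro G _ _ ih h
    obtain ⟨m, hm, hpow⟩ := ih fun q hq => by
      obtain ⟨g, rfl⟩ := QuotientGroup.mk_surjective q
      rw [← QuotientGroup.mk_pow, QuotientGroup.eq_one_iff, mem_center_iff]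
      intro k
      have hc : ⁅k, g⁆ ∈ center G := (mk_mul_comm_iff_commutatorElement_mem _ _ _).1
        (mem_center_iff.1 hq k)
      have hconj : k * g * k⁻¹ = ⁅k, g⁆ * g := by simp [commutatorElement_def]
      have hcomm : Commute ⁅k, g⁆ g := (mem_center_iff.1 hc g).symm
      have : k * g ^ n * k⁻¹ = g ^ n := by
        rw [← conj_pow, hconj, hcomm.mul_pow, h _ hc, one_mul]
      exact mul_inv_eq_iff_eq_mul.1 this
    refine ⟨m * n, Nat.mul_pos hm hn, fun g => ?_⟩
    rw [pow_mul]
    refine h _ ((QuotientGroup.eq_one_iff _).1 ?_)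
    rw [QuotientGroup.mk_pow, hpow]

theorem finite_of_center_isOfFinOrder (G : Type*) [Group G] [Group.IsNilpotent G]
    [WellFoundedGT (Subgroup G)] (h : ∀ z ∈ center G, IsOfFinOrder z) : Finite G := by
  have := finite_center_of_isOfFinOrder h
  obtain ⟨m, hm, hpow⟩ := exists_pow_eq_one_of_center G (n := Nat.card (center G)) Nat.card_pos
    fun z hz => congrArg Subtype.val (pow_card_eq_one' (x := (⟨z, hz⟩ : center G)))
  exact finite_of_isOfFinOrder G fun g => isOfFinOrder_iff_pow_eq_one.2 ⟨m, hm, hpow g⟩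

/-- In a Noetherian nilpotent group, every finite-index subgroup of the center contains the
intersection of the center with a normal subgroup of finite index. -/
theorem exists_normal_finiteIndex_inf_center_le (G : Type*) [Group G] [Group.IsNilpotent G]
    [WellFoundedGT (Subgroup G)] (A : Subgroup (center G)) [A.FiniteIndex] :
    ∃ M : Subgroup G, M.Normal ∧ M.FiniteIndex ∧ ∀ z : center G, (z : G) ∈ M → z ∈ A := by
  obtain ⟨M, ⟨hM, hMA⟩, hmax⟩ := WellFounded.has_min (wellFounded_gt (α := Subgroup G))
    {M : Subgroup G | M.Normal ∧ ∀ z : center G, (z : G) ∈ M → z ∈ A}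
    ⟨⊥, inferInstance, fun z hz => by
      rw [show z = 1 from Subtype.ext (mem_bot.1 hz)]
      exact one_mem A⟩
  have hle : ∀ L : Subgroup G, L.Normal → M ≤ L → (∀ z : center G, (z : G) ∈ L → z ∈ A) →
      L ≤ M := fun L hL hML hLA => by
    by_contra h
    exact hmax L ⟨hL, hLA⟩ (lt_of_le_not_ge hML h)
  have hAM : ∀ a ∈ A, (a : G) ∈ M := fun a ha => by
    have hN : (A.map (center G).subtype).Normal := ⟨fun x hx g => by
      obtain ⟨b, hb, rfl⟩ := hx
      refine ⟨b, hb, ?_⟩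
      simp [mem_center_iff.1 b.2 g]⟩
    refine hle (M ⊔ A.map (center G).subtype) inferInstance le_sup_left (fun z hz => ?_)
      (mem_sup_right ⟨a, ha, rfl⟩)
    obtain ⟨m, hm, _, ⟨b, hb, rfl⟩, hmb⟩ := mem_sup_of_normal_left.1 hz
    have h1 : z * b⁻¹ ∈ A := hMA _ (by
      have : ((z * b⁻¹ : center G) : G) = m := by simp [← hmb]
      rwa [this])
    simpa using mul_mem h1 hb
  refine ⟨M, hM, finiteIndex_iff_finite_quotient.2 ?_, hMA⟩
  have := wellFoundedGT_subgroup_quotient M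
  refine finite_of_center_isOfFinOrder _ fun q hq => ?_
  obtain ⟨g, rfl⟩ := QuotientGroup.mk_surjective q
  by_contra hfin
  have hN : ((zpowers (g : G ⧸ M)).comap (QuotientGroup.mk' M)).Normal := by
    have : (zpowers (g : G ⧸ M)).Normal := ⟨fun x hx k => by
      have := mem_center_iff.1 ((zpowers_le.2 hq) hx) k
      rwa [this, mul_inv_cancel_right]⟩
    infer_instance
  have hgM := hle _ hN (fun m hm => by
    have : (QuotientGroup.mk' M) m = 1 := (QuotientGroup.eq_one_iff m).2 hm
    rw [mem_comap, this]
    exact one_mem _) (fun z hz => by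
      obtain ⟨k, hk⟩ := hz
      obtain ⟨e, he, -, hzA⟩ := exists_pow_mem_of_index_ne_zero (H := A) FiniteIndex.index_ne_zero z
      have h1 : ((z : G) : G ⧸ M) ^ e = 1 := by
        rw [← QuotientGroup.mk_pow, QuotientGroup.eq_one_iff]
        exact hAM _ hzA
      have hk' : (g : G ⧸ M) ^ k = ((z : G) : G ⧸ M) := hk
      have h2 : (g : G ⧸ M) ^ (k * e) = 1 := by
        rw [zpow_mul, hk', zpow_natCast, h1]
      have hke : k * e = 0 := by
        by_contra h0
        exact hfin (isOfFinOrder_iff_zpow_eq_one.2 ⟨_, h0, h2⟩)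
      have hk0 : k = 0 := by
        rcases mul_eq_zero.1 hke with h | h
        · exact h
        · omega
      refine hMA z ((QuotientGroup.eq_one_iff _).1 ?_)
      rw [← hk', hk0, zpow_zero]) (mem_zpowers (g : G ⧸ M))
  refine hfin ?_
  rw [(QuotientGroup.eq_one_iff g).2 hgM]
  exact IsOfFinOrder.one

theorem finite_ker_of_finiteIndex_range {A : Type*} [CommGroup A] [WellFoundedGT (Subgroup A)]
    (δ : A →* A) [δ.range.FiniteIndex] : Finite δ.ker := by
  have := wellFoundedGT_subgroup_subgroup δ.ker
  have := fg_of_wellFoundedGT_subgroup δ.ker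
  refine CommGroup.finite_of_fg_isMulTorsion _ fun a => Submonoid.isOfFinOrder_coe.1 ?_
  have hn : δ.range.index ≠ 0 := FiniteIndex.index_ne_zero
  set n := δ.range.index
  let f : Monoid.End A := δ
  have hmono : Monotone fun k => (f ^ k : A →* A).ker := monotone_nat_of_le_succ fun k x hx => by
    change (f ^ (k + 1)) x = 1
    have hx' : (f ^ k) x = 1 := hx
    rw [pow_succ', Monoid.End.coe_mul, Function.comp_apply, hx', map_one]
  obtain ⟨k, hk⟩ := WellFoundedGT.monotone_chain_condition ⟨_, hmono⟩
  have hstep : ∀ j, ∃ b, (f ^ j) b = (a : A) ^ n ^ j := by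
    intro j
    induction j with
    | zero => exact ⟨a, by simp⟩
    | succ j ih =>
      obtain ⟨b, hb⟩ := ih
      obtain ⟨c, hc⟩ := pow_index_mem δ.range b
      refine ⟨c, ?_⟩
      rw [pow_succ, Monoid.End.coe_mul, Function.comp_apply, show f c = b ^ n from hc, map_pow, hb, ← pow_mul, pow_succ]
  obtain ⟨b, hb⟩ := hstep k
  have h1 : b ∈ (f ^ (k + 1) : A →* A).ker := by
    change (f ^ (k + 1)) b = 1
    rw [pow_succ', Monoid.End.coe_mul, Function.comp_apply, hb, map_pow, show f a = 1 from a.2, one_pow]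
  have h2 : (f ^ k) b = 1 := by
    have := hk (k + 1) (Nat.le_succ k)
    change (f ^ k : A →* A).ker = (f ^ (k + 1) : A →* A).ker at this
    rw [← this] at h1
    exact h1
  exact isOfFinOrder_iff_pow_eq_one.2 ⟨n ^ k, pow_pos (Nat.pos_of_ne_zero hn) k, hb.symm.trans h2⟩

/-- Finiteness of the Reidemeister number, in terms of a finite set of representatives. -/
def HasFiniteReidemeister {G : Type*} [Group G] (φ : G ≃* G) : Prop :=
  ∃ T : Set G, T.Finite ∧ ∀ x, ∃ t ∈ T, ∃ g, x = g * t * (φ g)⁻¹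

/-- The automorphism induced on the quotient by the center. -/
def quotientCenterCongr {G : Type*} [Group G] (φ : G ≃* G) : G ⧸ center G ≃* G ⧸ center G :=
  QuotientGroup.congr _ _ φ (characteristic_iff_map_eq.1 inferInstance φ)

theorem quotientCenterCongr_mk {G : Type*} [Group G] (φ : G ≃* G) (g : G) :
    quotientCenterCongr φ (g : G ⧸ center G) = (φ g : G ⧸ center G) := rfl

/-- The homomorphism `z ↦ z * (φ z)⁻¹` of the center. -/
def centerDisplacement {G : Type*} [Group G] (φ : G ≃* G) : center G →* center G :=
  MonoidHom.id _ / (centerCongr φ).toMonoidHom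

theorem coe_centerDisplacement {G : Type*} [Group G] (φ : G ≃* G) (z : center G) :
    (centerDisplacement φ z : G) = z * (φ z)⁻¹ := by
  change ((z / centerCongr φ z : center G) : G) = _
  rw [div_eq_mul_inv]
  rfl

theorem HasFiniteReidemeister.quotientCenterCongr {G : Type*} [Group G] {φ : G ≃* G}
    (h : HasFiniteReidemeister φ) : HasFiniteReidemeister (quotientCenterCongr φ) := by
  obtain ⟨T, hT, h⟩ := h
  refine ⟨QuotientGroup.mk '' T, hT.image _, fun q => ?_⟩
  obtain ⟨x, rfl⟩ := QuotientGroup.mk_surjective q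
  obtain ⟨t, ht, g, rfl⟩ := h x
  exact ⟨t, ⟨t, ht, rfl⟩, g, rfl⟩

theorem HasFiniteReidemeister.conj {G : Type*} [Group G] {φ : G ≃* G}
    (h : HasFiniteReidemeister φ) (x : G) :
    HasFiniteReidemeister (φ.trans (MulAut.conj x)) := by
  obtain ⟨T, hT, h⟩ := h
  refine ⟨(· * x⁻¹) '' T, hT.image _, fun y => ?_⟩
  obtain ⟨t, ht, g, hg⟩ := h (y * x)
  refine ⟨_, ⟨t, ht, rfl⟩, g, ?_⟩
  rw [eq_mul_inv_of_mul_eq hg]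
  simp [mul_assoc]

theorem finiteIndex_range_centerDisplacement {G : Type*} [Group G] {φ : G ≃* G}
    (h : HasFiniteReidemeister φ) (hfix : {q | quotientCenterCongr φ q = q}.Finite) :
    (centerDisplacement φ).range.FiniteIndex := by
  obtain ⟨T, hT, h⟩ := h
  choose t ht g hg using h
  have := hT.to_subtype
  have := hfix.to_subtype
  let τ : center G → T := fun z => ⟨t z, ht z⟩
  let r : center G → center G := fun z => Function.invFun τ (τ z)
  have hr : ∀ z, t (r z : G) = t z := fun z =>
    congrArg Subtype.val (Function.invFun_eq (f := τ) ⟨z, rfl⟩)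
  let k : center G → G := fun z => g z * (g (r z))⁻¹
  have hk : ∀ z : center G, (z : G) * (r z : G)⁻¹ = k z * (φ (k z))⁻¹ := fun z => by
    have h1 : (z : G) = k z * r z * (φ (k z))⁻¹ := by
      conv_lhs => rw [hg z, ← hr z]
      conv_rhs => rw [hg (r z : G)]
      simp only [k, map_mul, map_inv]
      group
    have h2 := mem_center_iff.1 (r z).2 (k z)
    rw [h2] at h1
    conv_lhs => rw [h1]
    have h3 := mem_center_iff.1 (inv_mem (r z).2) (r z * k z * (φ (k z))⁻¹)
    rw [h3]
    group
  have hkfix : ∀ z, quotientCenterCongr φ (k z) = k z := fun z => by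
    rw [quotientCenterCongr_mk, eq_comm, ← mul_inv_eq_one, ← QuotientGroup.mk_inv,
      ← QuotientGroup.mk_mul, QuotientGroup.eq_one_iff, ← hk]
    exact mul_mem z.2 (inv_mem (r z).2)
  have key : ∀ y z : center G, τ y = τ z → ((k y : G) : G ⧸ center G) = k z →
      (y : center G ⧸ (centerDisplacement φ).range) = z := fun y z hτ hyz => by
    have hryz : r y = r z := congrArg (Function.invFun τ) hτ
    obtain ⟨w, hw⟩ : ∃ w : center G, k z = k y * w :=
      ⟨⟨(k y)⁻¹ * k z, QuotientGroup.eq.1 hyz⟩, (mul_inv_cancel_left _ _).symm⟩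
    refine QuotientGroup.eq.2 ⟨w, Subtype.ext ?_⟩
    have hyr := eq_mul_of_mul_inv_eq (hk y)
    have hzr := eq_mul_of_mul_inv_eq (hk z)
    have hcomm := mem_center_iff.1 (centerDisplacement φ w).2 (φ (k y))⁻¹
    rw [coe_centerDisplacement] at hcomm ⊢
    rw [coe_mul, coe_inv, hyr, hzr, hw, ← hryz, map_mul φ (k y), mul_inv_rev (φ (k y)), mul_assoc (k y) (w : G),
      ← mul_assoc (w : G), ← hcomm]
    have hcomm' := mem_center_iff.1 (centerDisplacement φ w).2 (r y : G)
    rw [coe_centerDisplacement] at hcomm'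
    rw [eq_inv_mul_iff_mul_eq, mul_assoc, hcomm']
    group
  refine finiteIndex_iff_finite_quotient.2 (Finite.of_injective
    (fun q : center G ⧸ (centerDisplacement φ).range =>
      ((τ q.out, ⟨k q.out, hkfix _⟩) : T × {q | quotientCenterCongr φ q = q}))
    fun p q hpq => ?_)
  rw [← QuotientGroup.out_eq' p, ← QuotientGroup.out_eq' q]
  exact key _ _ (congrArg Prod.fst hpq) (congrArg (fun s => s.2.1) hpq)

theorem finite_fixed_of_hasFiniteReidemeister (G : Type*) [Group G] [Group.IsNilpotent G]
    [WellFoundedGT (Subgroup G)] (φ : G ≃* G) (h : HasFiniteReidemeister φ) :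
    {g | φ g = g}.Finite := by
  refine Group.nilpotent_center_quotient_ind (P := fun G _ _ =>
    ∀ φ : G ≃* G, HasFiniteReidemeister φ → WellFoundedGT (Subgroup G) → {g | φ g = g}.Finite)
    G ?_ ?_ φ h ‹_›
  · intro G _ _ _ _ _
    exact Set.toFinite _
  · intro G _ _ ih φ h _
    have hfix := ih _ h.quotientCenterCongr (wellFoundedGT_subgroup_quotient _)
    have := finiteIndex_range_centerDisplacement h hfix
    have := wellFoundedGT_subgroup_subgroup (center G)
    have hker := finite_ker_of_finiteIndex_range (centerDisplacement φ)
    refine Set.Finite.of_finite_fibers (QuotientGroup.mk : G → G ⧸ center G)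
      (hfix.subset ?_) ?_
    · rintro _ ⟨g, hg, rfl⟩
      exact congrArg QuotientGroup.mk hg
    · rintro _ ⟨g, hg, rfl⟩
      refine (Set.finite_range fun z : (centerDisplacement φ).ker => g * (z.1 : G)).subset ?_
      rintro x ⟨hx, hxg⟩
      have hc : g⁻¹ * x ∈ center G := QuotientGroup.eq.1 (Eq.symm hxg)
      refine ⟨⟨⟨g⁻¹ * x, hc⟩, Subtype.ext ?_⟩, mul_inv_cancel_left g x⟩
      rw [coe_centerDisplacement]
      simp [show φ g = g from hg, show φ x = x from hx]

theorem exists_finiteIndex_subset_twistedClass_one (G : Type*) [Group G] [Group.IsNilpotent G]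
    [WellFoundedGT (Subgroup G)] (φ : G ≃* G) (h : HasFiniteReidemeister φ)
    (M : Subgroup G) [M.FiniteIndex] :
    ∃ N : Subgroup G, N.FiniteIndex ∧ ∀ n ∈ N, ∃ g ∈ M, n = g * (φ g)⁻¹ := by
  refine Group.nilpotent_center_quotient_ind (P := fun G _ _ =>
    ∀ φ : G ≃* G, HasFiniteReidemeister φ → ∀ M : Subgroup G, M.FiniteIndex →
    WellFoundedGT (Subgroup G) →
    ∃ N : Subgroup G, N.FiniteIndex ∧ ∀ n ∈ N, ∃ g ∈ M, n = g * (φ g)⁻¹) G ?_ ?_ φ h M ‹_› ‹_›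
  · intro G _ _ _ _ M _ _
    exact ⟨⊤, inferInstance, fun n _ => ⟨1, one_mem M, Subsingleton.elim _ _⟩⟩
  · intro G _ _ ih φ h M _ _
    have := wellFoundedGT_subgroup_quotient (center G)
    have hfix := finite_fixed_of_hasFiniteReidemeister _ _ h.quotientCenterCongr
    have := finiteIndex_range_centerDisplacement h hfix
    have hA : ((M.subgroupOf (center G)).map (centerDisplacement φ)).FiniteIndex := ⟨by
      rw [index_map]
      have : (M.subgroupOf (center G) ⊔ (centerDisplacement φ).ker).FiniteIndex :=
        finiteIndex_of_le le_sup_left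
      exact mul_ne_zero FiniteIndex.index_ne_zero FiniteIndex.index_ne_zero⟩
    obtain ⟨L, hLn, hL, hLA⟩ := exists_normal_finiteIndex_inf_center_le G
      ((M.subgroupOf (center G)).map (centerDisplacement φ))
    have hL' : (L.comap φ.toMonoidHom).FiniteIndex := ⟨by
      rw [index_comap_of_surjective _ φ.surjective]
      exact hL.index_ne_zero⟩
    have hmap : ((M ⊓ L ⊓ L.comap φ.toMonoidHom).map
        (QuotientGroup.mk' (center G))).FiniteIndex := ⟨ne_zero_of_dvd_ne_zero
          FiniteIndex.index_ne_zero (index_map_dvd _ (QuotientGroup.mk'_surjective _))⟩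
    obtain ⟨N, hN, hNM⟩ := ih _ h.quotientCenterCongr _ hmap ‹_›
    have hN' : (N.comap (QuotientGroup.mk' (center G))).FiniteIndex := ⟨by
      rw [index_comap_of_surjective _ (QuotientGroup.mk'_surjective _)]
      exact hN.index_ne_zero⟩
    refine ⟨N.comap (QuotientGroup.mk' (center G)) ⊓ L, inferInstance, fun n hn => ?_⟩
    obtain ⟨_, ⟨g, ⟨⟨hgM, hgL⟩, hgL'⟩, rfl⟩, hg⟩ := hNM _ hn.1
    have hgn : (φ g * g⁻¹) * n ∈ center G := by
      rw [← QuotientGroup.eq_one_iff, QuotientGroup.mk_mul]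
      rw [show (n : G ⧸ center G) = g * (φ g : G ⧸ center G)⁻¹ from hg]
      simp
    obtain ⟨z, hz, hzδ⟩ := hLA ⟨_, hgn⟩ (mul_mem (mul_mem hgL' (inv_mem hgL)) hn.2)
    refine ⟨g * z, mul_mem hgM hz, ?_⟩
    have h1 : (z : G) * (φ z)⁻¹ = φ g * g⁻¹ * n := by
      rw [← coe_centerDisplacement, hzδ]
    have h2 : n = g * (φ g)⁻¹ * (z * (φ z)⁻¹) := by
      rw [h1]
      group
    have h3 : (z : G) * (φ z)⁻¹ ∈ center G := by
      rw [h1]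
      exact hgn
    rw [h2, mul_assoc, mem_center_iff.1 h3, map_mul]
    group

theorem finite_quotient_normalClosure_pow (G : Type*) [Group G] [Group.FG G] [Group.IsNilpotent G]
    {n : ℕ} (hn : 0 < n) : Finite (G ⧸ normalClosure (Set.range fun g : G => g ^ n)) := by
  have := wellFoundedGT_subgroup_of_fg_of_isNilpotent
    (G ⧸ normalClosure (Set.range fun g : G => g ^ n))
  refine finite_of_isOfFinOrder _ fun q => ?_
  obtain ⟨g, rfl⟩ := QuotientGroup.mk_surjective q
  refine isOfFinOrder_iff_pow_eq_one.2 ⟨n, hn, ?_⟩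
  rw [← QuotientGroup.mk_pow, QuotientGroup.eq_one_iff]
  exact subset_normalClosure ⟨g, rfl⟩

theorem map_normalClosure_range_pow {G : Type*} [Group G] (φ : G ≃* G) (n : ℕ) :
    (normalClosure (Set.range fun g : G => g ^ n)).map φ.toMonoidHom =
      normalClosure (Set.range fun g : G => g ^ n) := by
  rw [map_normalClosure _ _ φ.surjective, ← Set.range_comp]
  congr 1
  ext x
  constructor
  · rintro ⟨g, rfl⟩
    exact ⟨φ g, (map_pow φ g n).symm⟩
  · rintro ⟨g, rfl⟩
    exact ⟨φ.symm g, by simp⟩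

/-- If every twisted class is stable under right multiplication by an invariant normal subgroup of
finite index, then the quotient witnesses `RPcond`. -/
theorem rpcond_of_mul_mem_twistedClass {G : Type*} [Group G] (φ : G ≃* G) (P : Subgroup G)
    [P.Normal] [Finite (G ⧸ P)] (hφ : P.map φ.toMonoidHom = P)
    (h : ∀ x, ∀ y ∈ twistedClass φ.toMonoidHom x, ∀ p ∈ P, y * p ∈ twistedClass φ.toMonoidHom x) :
    RPcond φ.toMonoidHom := by
  let E : G ⧸ P ≃* Shrink.{0} (G ⧸ P) := Shrink.mulEquiv.symm
  refine ⟨Shrink.{0} (G ⧸ P), inferInstance, Finite.of_equiv _ E.toEquiv,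
    (E.symm.trans (QuotientGroup.congr P P φ hφ)).trans E,
    E.toMonoidHom.comp (QuotientGroup.mk' P),
    E.surjective.comp (QuotientGroup.mk'_surjective P), fun g => ?_, fun x => ?_⟩
  · change E (φ g : G) = E (QuotientGroup.congr P P φ hφ (E.symm (E g)))
    rw [E.symm_apply_apply]
    rfl
  · refine ⟨E.toMonoidHom.comp (QuotientGroup.mk' P) '' twistedClass φ.toMonoidHom x,
      (Set.subset_preimage_image _ _).antisymm ?_⟩
    rintro z ⟨y, hy, hyz⟩
    have hp : y⁻¹ * z ∈ P := QuotientGroup.eq.1 (E.injective hyz)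
    simpa using h x y hy _ hp

theorem hasFiniteReidemeister_of_finite_range {G : Type*} [Group G] {φ : G ≃* G}
    (h : (Set.range (twistedClass φ.toMonoidHom)).Finite) : HasFiniteReidemeister φ := by
  have := h.to_subtype
  choose f hf using fun c : Set.range (twistedClass φ.toMonoidHom) => c.2
  refine ⟨Set.range f, Set.finite_range f, fun x => ⟨_, ⟨⟨_, x, rfl⟩, rfl⟩, ?_⟩⟩
  have hx : x ∈ twistedClass φ.toMonoidHom x := ⟨1, by simp⟩
  obtain ⟨g, hg⟩ := (hf ⟨_, x, rfl⟩).ge hx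
  exact ⟨g, by simpa using hg⟩

/-- Every finitely generated nilpotent group has property RP: every automorphism
with finite Reidemeister number satisfies RP(φ). -/
theorem stmt15 {G : Type*} [Group G] [Group.FG G] [Group.IsNilpotent G] :
    ∀ φ : G ≃* G, (Set.range (twistedClass φ.toMonoidHom)).Finite →
      RPcond φ.toMonoidHom := by
  intro φ hφ
  have hR := hasFiniteReidemeister_of_finite_range hφ
  have := wellFoundedGT_subgroup_of_fg_of_isNilpotent G
  choose N hN hNg using fun t : G =>
    exists_finiteIndex_subset_twistedClass_one G _ (hR.conj t) ⊤
  obtain ⟨T, hT, hTx⟩ := hR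
  have := hT.to_subtype
  have hI : (⨅ t : T, N t).FiniteIndex := finiteIndex_iInf fun t => hN t
  set I := (⨅ t : T, N t).normalCore
  have hn : 0 < I.index := Nat.pos_of_ne_zero FiniteIndex.index_ne_zero
  have := finite_quotient_normalClosure_pow G hn
  refine rpcond_of_mul_mem_twistedClass φ
    (normalClosure (Set.range fun g : G => g ^ I.index)) (map_normalClosure_range_pow φ _) ?_
  rintro x _ ⟨a, rfl⟩ p hp
  obtain ⟨t, ht, g, rfl⟩ := hTx x
  have hpI : p ∈ I := normalClosure_le_normal (Set.range_subset_iff.2 (pow_index_mem I)) hp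
  set b := a * g with hb
  have hq : t * ((φ b)⁻¹ * p * φ b) * t⁻¹ ∈ N t := by
    have hnI : I.Normal := inferInstance
    have h1 : t * ((φ b)⁻¹ * p * φ b) * t⁻¹ ∈ I :=
      hnI.conj_mem _ (by simpa using hnI.conj_mem p hpI (φ b)⁻¹) t
    exact (iInf_le (fun t : T => N t) ⟨t, ht⟩) (normalCore_le _ h1)
  obtain ⟨c, -, hc⟩ := hNg t _ hq
  refine ⟨b * c * g⁻¹, ?_⟩
  have hc' : t * ((φ b)⁻¹ * p * φ b) * t⁻¹ = c * (t * φ c * t⁻¹)⁻¹ := hc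
  have hp' : p = φ b * t⁻¹ * (c * (t * φ c * t⁻¹)⁻¹) * t * (φ b)⁻¹ := by
    rw [← hc']
    group
  rw [hp']
  simp only [hb, MulEquiv.toMonoidHom_eq_coe, MonoidHom.coe_coe, map_mul, map_inv]
  group
end

section
/- Let G be the semidirect product (ℤ ⊕ ℤ) ⋊_α ℤ, where α is the automorphism of ℤ ⊕ ℤ given by the matrix [[2,1],[1,1]]; elements of G are triples ((m,k),n) with multiplication ((m,k),n)*((m',k'),n') = ((m,k) + αⁿ(m',k'), n+n'). Define φ: G → G by φ((m,k),n) = ((k,−m),−n). Then φ is an automorphism of G and its Reidemeister number is R(φ) = 4. -/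
/-- The hyperbolic automorphism of `ℤ ⊕ ℤ` with matrix `[[2,1],[1,1]]`:
`(m, k) ↦ (2m + k, m + k)`. -/
def hypAuto : (ℤ × ℤ) ≃+ (ℤ × ℤ) where
  toFun p := (2 * p.1 + p.2, p.1 + p.2)
  invFun p := (p.1 - p.2, -p.1 + 2 * p.2)
  left_inv p := by ext <;> dsimp <;> ring
  right_inv p := by ext <;> dsimp <;> ring
  map_add' p q := by ext <;> dsimp <;> ring

/-- The group `G = (ℤ ⊕ ℤ) ⋊_α ℤ`, where `1 ∈ ℤ` acts by `α = [[2,1],[1,1]]`. -/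
abbrev Gex : Type :=
  SemidirectProduct (Multiplicative (ℤ × ℤ)) (Multiplicative ℤ)
    (zpowersHom (MulAut (Multiplicative (ℤ × ℤ))) (AddEquiv.toMultiplicative hypAuto))

/-- The automorphism `(m, k) ↦ (k, -m)` of `ℤ ⊕ ℤ`. -/
def quarterTurn : (ℤ × ℤ) ≃+ (ℤ × ℤ) where
  toFun p := (p.2, -p.1)
  invFun p := (-p.2, p.1)
  left_inv p := by simp
  right_inv p := by simp
  map_add' p q := by ext <;> dsimp; ring

namespace Gex

/-- `hypAuto` in multiplicative notation. -/
abbrev A : MulAut (Multiplicative (ℤ × ℤ)) := AddEquiv.toMultiplicative hypAuto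

/-- `quarterTurn` in multiplicative notation. -/
abbrev J : MulAut (Multiplicative (ℤ × ℤ)) := AddEquiv.toMultiplicative quarterTurn

theorem semiconjBy_J_A : SemiconjBy J A A⁻¹ := by
  rw [SemiconjBy, eq_inv_mul_iff_mul_eq]
  ext p : 1
  apply Multiplicative.toAdd.injective
  change hypAuto (quarterTurn (hypAuto p.toAdd)) = quarterTurn p.toAdd
  ext <;> simp [hypAuto, quarterTurn] <;> ring

theorem J_A_zpow (n : ℤ) (p : Multiplicative (ℤ × ℤ)) : J ((A ^ n) p) = (A ^ (-n)) (J p) := by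
  have h := (semiconjBy_J_A.zpow_right n).eq
  rw [inv_zpow'] at h
  exact DFunLike.congr_fun h p

/-- The automorphism `((m, k), n) ↦ ((k, -m), -n)`. -/
def flip : Gex ≃* Gex :=
  SemidirectProduct.congr J (MulEquiv.inv (Multiplicative ℤ)) fun n => by
    ext p : 1
    exact J_A_zpow n.toAdd p

theorem A_zpow_zpow (m n : ℤ) (p : Multiplicative (ℤ × ℤ)) :
    (A ^ m) ((A ^ n) p) = (A ^ (m + n)) p := by
  rw [zpow_add]; rfl

theorem right_twist (g x : Gex) :
    (g * x * flip g⁻¹).right.toAdd = x.right.toAdd + 2 * g.right.toAdd := by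
  change g.right.toAdd + x.right.toAdd + -(-g.right.toAdd) = _
  ring

theorem left_twist (g x : Gex) :
    (g * x * flip g⁻¹).left = g.left * (A ^ g.right.toAdd) x.left *
      ((A ^ (x.right.toAdd + 2 * g.right.toAdd)) (J g.left))⁻¹ := by
  change g.left * (A ^ g.right.toAdd) x.left * (A ^ (g.right.toAdd + x.right.toAdd))
    (J ((A ^ (-g.right.toAdd)) g.left⁻¹)) = _
  rw [J_A_zpow, A_zpow_zpow, map_inv, map_inv]
  congr 4
  ring

/-- The first component of the twisted conjugate of `x` lying over `0` or `1`. -/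
def red (x : Gex) : Multiplicative (ℤ × ℤ) := (A ^ (-(x.right.toAdd / 2))) x.left

theorem mem_twistedClass_iff (x y : Gex) :
    y ∈ twistedClass flip.toMonoidHom x ↔ x.right.toAdd % 2 = y.right.toAdd % 2 ∧
      ∃ w, red y = w * red x * ((A ^ (x.right.toAdd % 2)) (J w))⁻¹ := by
  constructor
  · rintro ⟨g, hg⟩
    have hr : y.right.toAdd = x.right.toAdd + 2 * g.right.toAdd := hg ▸ right_twist g x
    have hl : y.left = _ := hg ▸ left_twist g x
    refine ⟨by lia, (A ^ (-(y.right.toAdd / 2))) g.left, ?_⟩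
    rw [red, red, hl, map_mul, map_mul, map_inv, J_A_zpow, A_zpow_zpow, A_zpow_zpow, A_zpow_zpow,
      show -(y.right.toAdd / 2) + g.right.toAdd = -(x.right.toAdd / 2) by lia,
      show -(y.right.toAdd / 2) + (x.right.toAdd + 2 * g.right.toAdd) =
        x.right.toAdd % 2 + -(-(y.right.toAdd / 2)) by lia]
  · rintro ⟨hr, w, hw⟩
    obtain ⟨n, hn⟩ : ∃ n, y.right.toAdd = x.right.toAdd + 2 * n :=
      ⟨y.right.toAdd / 2 - x.right.toAdd / 2, by lia⟩
    refine ⟨⟨(A ^ (y.right.toAdd / 2)) w, .ofAdd n⟩, ?_⟩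
    apply SemidirectProduct.ext
    · refine Eq.trans ?_ (left_twist _ x).symm
      have h := congrArg (A ^ (y.right.toAdd / 2)) hw
      rw [red, red, map_mul, map_mul, map_inv, A_zpow_zpow, A_zpow_zpow, A_zpow_zpow,
        add_neg_cancel, zpow_zero, MulAut.one_apply] at h
      rw [h]
      dsimp only
      rw [J_A_zpow, A_zpow_zpow, toAdd_ofAdd,
        show y.right.toAdd / 2 + -(x.right.toAdd / 2) = n by lia,
        show y.right.toAdd / 2 + x.right.toAdd % 2 =
          x.right.toAdd + 2 * n + -(y.right.toAdd / 2) by lia]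
    · exact Multiplicative.toAdd.injective
        (hn.trans (right_twist ⟨(A ^ (y.right.toAdd / 2)) w, .ofAdd n⟩ x).symm)

theorem exists_sub_quarterTurn_iff (p q : ℤ × ℤ) :
    (∃ w, q = w + p - quarterTurn w) ↔ ((p.1 + p.2 : ℤ) : ZMod 2) = ((q.1 + q.2 : ℤ) : ZMod 2) := by
  rw [ZMod.intCast_eq_intCast_iff_dvd_sub]
  constructor
  · rintro ⟨w, rfl⟩
    exact ⟨w.1, by simp [quarterTurn]; ring⟩
  · rintro ⟨c, hc⟩
    refine ⟨(c, c - (q.1 - p.1)), ?_⟩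
    ext <;> simp only [quarterTurn, AddEquiv.coe_mk, Equiv.coe_fn_mk, Prod.fst_add, Prod.snd_add,
      Prod.fst_sub, Prod.snd_sub] <;> lia

theorem exists_sub_hypAuto_quarterTurn_iff (p q : ℤ × ℤ) :
    (∃ w, q = w + p - hypAuto (quarterTurn w)) ↔ (p.1 : ZMod 2) = (q.1 : ZMod 2) := by
  rw [ZMod.intCast_eq_intCast_iff_dvd_sub]
  constructor
  · rintro ⟨w, rfl⟩
    exact ⟨w.1 - w.2, by simp [quarterTurn, hypAuto]; ring⟩
  · rintro ⟨c, hc⟩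
    refine ⟨(q.2 - p.2, q.2 - p.2 - c), ?_⟩
    ext <;> simp only [quarterTurn, hypAuto, AddEquiv.coe_mk, Equiv.coe_fn_mk, Prod.fst_add,
      Prod.snd_add, Prod.fst_sub, Prod.snd_sub] <;> lia

/-- A complete invariant of the `flip`-conjugacy class of `x`. -/
def classInvariant (x : Gex) : ZMod 2 × ZMod 2 :=
  ((x.right.toAdd : ℤ),
    if x.right.toAdd % 2 = 0 then (((red x).toAdd.1 + (red x).toAdd.2 : ℤ) : ZMod 2)
    else ((red x).toAdd.1 : ℤ))

theorem mem_twistedClass_iff_classInvariant_eq (x y : Gex) :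
    y ∈ twistedClass flip.toMonoidHom x ↔ classInvariant x = classInvariant y := by
  rw [mem_twistedClass_iff, classInvariant, classInvariant, Prod.mk.injEq,
    ZMod.intCast_eq_intCast_iff]
  refine and_congr_right fun h => ?_
  rw [← h]
  rcases Int.emod_two_eq_zero_or_one x.right.toAdd with h0 | h0
  · rw [h0, if_pos rfl, if_pos rfl, ← exists_sub_quarterTurn_iff, zpow_zero]
    simp only [sub_eq_add_neg]
    rfl
  · rw [h0, if_neg one_ne_zero, if_neg one_ne_zero, ← exists_sub_hypAuto_quarterTurn_iff, zpow_one]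
    simp only [sub_eq_add_neg]
    rfl

theorem classInvariant_surjective : Function.Surjective classInvariant := by
  rintro ⟨a, b⟩
  refine ⟨⟨.ofAdd (b.val, 0), .ofAdd a.val⟩, ?_⟩
  fin_cases a <;> fin_cases b <;> simp [classInvariant, red, ZMod.val] <;> rfl

theorem twistedClass_eq_iff (x y : Gex) :
    twistedClass flip.toMonoidHom x = twistedClass flip.toMonoidHom y ↔
      classInvariant x = classInvariant y := by
  refine ⟨fun h => ?_, fun h => ?_⟩
  · rw [← mem_twistedClass_iff_classInvariant_eq, h, mem_twistedClass_iff_classInvariant_eq]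
  · ext z
    rw [mem_twistedClass_iff_classInvariant_eq, mem_twistedClass_iff_classInvariant_eq, h]

theorem card_range_twistedClass : Nat.card (Set.range (twistedClass flip.toMonoidHom)) = 4 := by
  have hker : Setoid.ker (twistedClass flip.toMonoidHom) = Setoid.ker classInvariant :=
    Setoid.ext twistedClass_eq_iff
  rw [← Nat.card_congr (Setoid.quotientKerEquivRange _), hker,
    Nat.card_congr (Setoid.quotientKerEquivOfSurjective _ classInvariant_surjective)]
  simp

end Gex

/-- The map `φ((m,k),n) = ((k,−m),−n)` is an automorphism of
`G = (ℤ ⊕ ℤ) ⋊_α ℤ` and its Reidemeister number is `R(φ) = 4`. -/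
theorem stmt16 :
    ∃ φ : Gex ≃* Gex,
      (∀ p : ℤ × ℤ, ∀ z : ℤ,
        φ ⟨Multiplicative.ofAdd p, Multiplicative.ofAdd z⟩ =
          ⟨Multiplicative.ofAdd (p.2, -p.1), Multiplicative.ofAdd (-z)⟩) ∧
      Nat.card (Set.range (twistedClass φ.toMonoidHom)) = 4 := by
  exact ⟨Gex.flip, fun _ _ => rfl, Gex.card_range_twistedClass⟩
end

section
/- For an integer n > 1, every injective group homomorphism φ: B(1,n) → B(1,n) has infinite Reidemeister number, i.e. the set of φ-conjugacy classes of B(1,n) is infinite. -/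
/-- The Baumslag–Solitar relator set for `B(1,n)`: the single relator
`a⁻¹ * b * a * b⁻ⁿ`, with `a = of true` and `b = of false`. -/
def bsRel (n : ℕ) : Set (FreeGroup Bool) :=
  {(FreeGroup.of true)⁻¹ * FreeGroup.of false * FreeGroup.of true *
    ((FreeGroup.of false) ^ n)⁻¹}

/-- The Baumslag–Solitar group `B(1,n) = ⟨a, b : a⁻¹ b a = bⁿ⟩`. -/
abbrev BS (n : ℕ) : Type := PresentedGroup (bsRel n)

namespace BS

variable {n : ℕ}

/-- The stable letter `a` of `B(1,n)`. -/
def a (n : ℕ) : BS n := PresentedGroup.of true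

/-- The base generator `b` of `B(1,n)`. -/
def b (n : ℕ) : BS n := PresentedGroup.of false

lemma b_mul_a (n : ℕ) : b n * a n = a n * b n ^ n := by
  have h : (a n)⁻¹ * b n * a n * (b n ^ n)⁻¹ = 1 :=
    PresentedGroup.one_of_mem (rels := bsRel n) (Set.mem_singleton _)
  rw [mul_inv_eq_one, mul_assoc, inv_mul_eq_iff_eq_mul] at h
  exact h

lemma b_zpow_mul_a (m : ℤ) : b n ^ m * a n = a n * b n ^ (n * m : ℤ) := by
  have h : SemiconjBy (a n) (b n ^ n) (b n) := (b_mul_a n).symm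
  have h' := h.zpow_right m
  rw [← zpow_natCast, ← zpow_mul] at h'
  exact h'.symm

lemma b_mul_a_pow (i : ℕ) : b n * a n ^ i = a n ^ i * b n ^ ((n : ℤ) ^ i) := by
  induction i with
  | zero => simp
  | succ i ih =>
    rw [pow_succ, ← mul_assoc, ih, mul_assoc, b_zpow_mul_a, ← mul_assoc, pow_succ' (n : ℤ)]

/-- The elements of `B(1,n)` of the form `aⁱ bᵐ a⁻ʲ` with `i, j ≥ 0`. -/
def IsNormalForm (x : BS n) : Prop :=
  ∃ (i : ℕ) (m : ℤ) (j : ℕ), x = a n ^ i * b n ^ m * (a n ^ j)⁻¹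

lemma IsNormalForm.a_mul {x : BS n} (hx : IsNormalForm x) : IsNormalForm (a n * x) := by
  obtain ⟨i, m, j, rfl⟩ := hx
  exact ⟨i + 1, m, j, by simp only [pow_succ', mul_assoc]⟩

lemma IsNormalForm.a_inv_mul {x : BS n} (hx : IsNormalForm x) :
    IsNormalForm ((a n)⁻¹ * x) := by
  obtain ⟨i, m, j, rfl⟩ := hx
  cases i with
  | zero =>
    refine ⟨0, n * m, j + 1, ?_⟩
    have h : (a n)⁻¹ * b n ^ m = b n ^ (n * m : ℤ) * (a n)⁻¹ := by
      rw [inv_mul_eq_iff_eq_mul, ← mul_assoc, eq_mul_inv_iff_mul_eq, b_zpow_mul_a]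
    rw [pow_zero, one_mul, one_mul, ← mul_assoc, h, pow_succ, mul_inv_rev, mul_assoc]
  | succ i => exact ⟨i, m, j, by rw [pow_succ']; group⟩

lemma IsNormalForm.b_zpow_mul {x : BS n} (hx : IsNormalForm x) (k : ℤ) :
    IsNormalForm (b n ^ k * x) := by
  obtain ⟨i, m, j, rfl⟩ := hx
  refine ⟨i, (n : ℤ) ^ i * k + m, j, ?_⟩
  have h : SemiconjBy (a n ^ i) (b n ^ ((n : ℤ) ^ i)) (b n) := (b_mul_a_pow i).symm
  have h' := (h.zpow_right k).eq
  rw [← zpow_mul] at h'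
  rw [zpow_add, ← mul_assoc, ← mul_assoc, ← mul_assoc, h']

lemma isNormalForm (x : BS n) : IsNormalForm x := by
  have hx : x ∈ Subgroup.closure (Set.range (PresentedGroup.of (rels := bsRel n))) :=
    PresentedGroup.closure_range_of (bsRel n) ▸ Subgroup.mem_top x
  induction hx using Subgroup.closure_induction_left with
  | one => exact ⟨0, 0, 0, by simp⟩
  | mul_left g hg y _ ih =>
    obtain ⟨c, rfl⟩ := hg
    cases c with
    | true => exact ih.a_mul
    | false => simpa [b] using ih.b_zpow_mul 1
  | inv_mul_cancel g hg y _ ih =>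
    obtain ⟨c, rfl⟩ := hg
    cases c with
    | true => exact ih.a_inv_mul
    | false => simpa [b] using ih.b_zpow_mul (-1)

/-- The exponent sum of `a`. -/
def exponentSum (n : ℕ) : BS n →* Multiplicative ℤ :=
  PresentedGroup.toGroup (f := fun c => if c then Multiplicative.ofAdd 1 else 1) (by
    rintro _ rfl
    simp)

@[simp] lemma exponentSum_a : exponentSum n (a n) = Multiplicative.ofAdd 1 := by
  simp [exponentSum, a]

@[simp] lemma exponentSum_b : exponentSum n (b n) = 1 := by
  simp [exponentSum, b]

/-- The action of `B(1,n)` on `ℚ` in which `a` divides by `n` and `b` adds `1`. -/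
def affineAction (n : ℕ) (hn : (n : ℚ) ≠ 0) : BS n →* Equiv.Perm ℚ :=
  PresentedGroup.toGroup
    (f := fun c => if c then (Equiv.mulLeft₀ (n : ℚ) hn)⁻¹ else Equiv.addRight 1) (by
    rintro _ rfl
    simp only [map_mul, map_inv, map_pow, FreeGroup.lift_apply_of, mul_inv_eq_one]
    ext q
    simp [Equiv.Perm.inv_def]
    field_simp)

variable (hn : (n : ℚ) ≠ 0)

lemma affineAction_a : affineAction n hn (a n) = (Equiv.mulLeft₀ (n : ℚ) hn)⁻¹ := by
  simp [affineAction, a]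

lemma affineAction_b : affineAction n hn (b n) = Equiv.addRight 1 := by
  simp [affineAction, b]

lemma affineAction_a_pow_inv (i : ℕ) (q : ℚ) :
    affineAction n hn (a n ^ i)⁻¹ q = (n : ℚ) ^ i * q := by
  rw [map_inv, map_pow, affineAction_a, inv_pow, inv_inv]
  induction i generalizing q with
  | zero => simp
  | succ i ih => rw [pow_succ, Equiv.Perm.mul_apply, ih]; simp [pow_succ, mul_assoc]

lemma affineAction_a_pow (i : ℕ) (q : ℚ) :
    affineAction n hn (a n ^ i) q = q / (n : ℚ) ^ i := by
  apply (affineAction n hn (a n ^ i)⁻¹).injective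
  rw [← Equiv.Perm.mul_apply, ← map_mul, inv_mul_cancel, map_one, Equiv.Perm.one_apply,
    affineAction_a_pow_inv]
  field_simp

lemma affineAction_normalForm (i : ℕ) (m : ℤ) (j : ℕ) (q : ℚ) :
    affineAction n hn (a n ^ i * b n ^ m * (a n ^ j)⁻¹) q =
      ((n : ℚ) ^ j * q + m) / (n : ℚ) ^ i := by
  rw [map_mul, map_mul, Equiv.Perm.mul_apply, Equiv.Perm.mul_apply, affineAction_a_pow_inv,
    affineAction_a_pow, map_zpow, affineAction_b, Equiv.zsmul_addRight]
  simp

/-- An injective endomorphism of `B(1,n)` preserves the exponent sum of `a`. -/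
lemma exponentSum_comp_of_injective (h1 : 1 < n) (φ : BS n →* BS n)
    (hinj : Function.Injective φ) : (exponentSum n).comp φ = exponentSum n := by
  have hn : (n : ℚ) ≠ 0 := by positivity
  obtain ⟨i, m, j, ha⟩ := isNormalForm (φ (a n))
  obtain ⟨p, q, r, hb⟩ := isNormalForm (φ (b n))
  have hrel : φ (b n) * φ (a n) = φ (a n) * φ (b n) ^ n := by
    rw [← map_mul, b_mul_a, map_mul, map_pow]
  have hεb : exponentSum n (φ (b n)) = 1 := by
    have h := congrArg (fun x => (exponentSum n x).toAdd) hrel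
    simp only [map_mul, map_pow, toAdd_mul, toAdd_pow, nsmul_eq_mul] at h
    have h' : ((n : ℤ) - 1) * (exponentSum n (φ (b n))).toAdd = 0 := by linarith
    rcases mul_eq_zero.mp h' with h' | h'
    · omega
    · exact h'
  have hpr : p = r := by
    rw [hb] at hεb
    have h := congrArg Multiplicative.toAdd hεb
    simp at h
    omega
  subst hpr
  have hq : q ≠ 0 := by
    rintro rfl
    have hb1 : b n = 1 := hinj (by rw [hb]; simp)
    have h := affineAction_b hn
    rw [hb1, map_one] at h
    simpa using congrArg (fun e : Equiv.Perm ℚ => e 0) h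
  have hρb : affineAction n hn (φ (b n)) = Equiv.addRight ((q : ℚ) / (n : ℚ) ^ p) := by
    ext x
    rw [hb, affineAction_normalForm, Equiv.coe_addRight]
    field_simp
  have hij : i = j + 1 := by
    have h := congrArg (fun x => affineAction n hn x 0) hrel
    simp only [map_mul, map_pow, Equiv.Perm.mul_apply, hρb, Equiv.nsmul_addRight] at h
    rw [ha, affineAction_normalForm, affineAction_normalForm] at h
    have hq' : (q : ℚ) ≠ 0 := by exact_mod_cast hq
    simp only [Equiv.coe_addRight, nsmul_eq_mul] at h
    field_simp at h
    have h' : (n : ℚ) ^ i = (n : ℚ) ^ (j + 1) := by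
      apply mul_left_cancel₀ hq'
      rw [pow_succ]
      linarith
    exact Nat.pow_right_injective h1 (by exact_mod_cast h')
  apply PresentedGroup.ext
  rintro (_ | _)
  · exact hεb.trans exponentSum_b.symm
  · refine Eq.trans ?_ exponentSum_a.symm
    change exponentSum n (φ (a n)) = _
    rw [ha, hij]
    apply Multiplicative.toAdd.injective
    simp

end BS

/-- Every injective endomorphism of a Baumslag–Solitar group `B(1,n)` (`n > 1`)
has infinitely many twisted conjugacy classes. -/
theorem stmt19 (n : ℕ) (hn : 1 < n) (φ : BS n →* BS n)
    (hinj : Function.Injective φ) :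
    (Set.range (twistedClass φ)).Infinite := by
  have hε (g : BS n) : BS.exponentSum n (φ g) = BS.exponentSum n g :=
    DFunLike.congr_fun (BS.exponentSum_comp_of_injective hn φ hinj) g
  have hz : Function.Injective fun z : ℤ => twistedClass φ (BS.a n ^ z) := by
    intro z w (h : twistedClass φ (BS.a n ^ z) = twistedClass φ (BS.a n ^ w))
    have hmem : BS.a n ^ z ∈ twistedClass φ (BS.a n ^ z) := ⟨1, by simp⟩
    rw [h] at hmem
    obtain ⟨g, hg⟩ := hmem
    have h' := congrArg (fun x => (BS.exponentSum n x).toAdd) hg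
    simpa [hε] using h'
  exact (Set.infinite_range_of_injective hz).mono
    (Set.range_comp_subset_range (fun z : ℤ => BS.a n ^ z) (twistedClass φ))
end
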